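/- Let p ≥ 1 and suppose M_ϖ(p) < ∞ and M_ϖ(p+1) < ∞. Then for every n ≥ 1 and every s > 0, β_{1,n}(s) ≤ s^{−p}·( n^{−1}·M_ϖ(p+1) + M_ϖ(p) ), where β_{1,n}(s) := ∫∫ 1{ h_n(x,y) ≤ 1/s } q^w(x,y) π(x) dy dx and h_n(x,y) := ∫_{(ℝ^d)^{n−1}} [ n/(ϖ(x,y) + Σ_{i=2}^n ϖ(x,y_i)) ] Π_{i=2}^n q(x,y_i) dy_i. -/

import Mathlib

open MeasureTheory ENNReal Finset

noncomputable section

/-- `ℝ^d` with Lebesgue measure. -/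
abbrev Rd (d : ℕ) := Fin d → ℝ

variable {d : ℕ}

/-- `(qw)(x) = ∫ q(x,y) w(x,y) dy`. -/
def qwInt (q w : Rd d → Rd d → ℝ) (x : Rd d) : ℝ := ∫ y, q x y * w x y

/-- The importance weights `ϖ(x,y) = w(x,y)/(qw)(x)`. -/
def impW (q w : Rd d → Rd d → ℝ) (x y : Rd d) : ℝ := w x y / qwInt q w x

/-- `r(x,y) = (π(y) q(y,x) w(y,x)) / (π(x) q(x,y) w(x,y))`. -/
def accRatio (pi : Rd d → ℝ) (q w : Rd d → Rd d → ℝ) (x y : Rd d) : ℝ :=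
  (pi y * q y x * w y x) / (pi x * q x y * w x y)

/-- `(q̃w)ₙ(x,y)`, the harmonic-mean normalisation of the resampling proposal. -/
def qtw (q w : Rd d → Rd d → ℝ) (n : ℕ) (x y : Rd d) : ℝ :=
  (∫ ys : Fin (n - 1) → Rd d,
    ((w x y + ∑ i, w x (ys i)) / n)⁻¹ * ∏ i, q x (ys i))⁻¹

/-- Off-diagonal transition density of the semi-ideal kernel `P̃ₙ`. -/
def pSemi (pi : Rd d → ℝ) (q w : Rd d → Rd d → ℝ) (n : ℕ) (x y : Rd d) : ℝ :=
  q x y * w x y *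
    min (qtw q w n x y)⁻¹ (accRatio pi q w x y / qtw q w n y x)

/-- Off-diagonal transition density of the Multiple-try Metropolis kernel `Pₙ`. -/
def pMTM (pi : Rd d → ℝ) (q w : Rd d → Rd d → ℝ) (n : ℕ) (x y : Rd d) : ℝ :=
  q x y * w x y *
    ∫ ys : Fin (n - 1) → Rd d, ∫ zs : Fin (n - 1) → Rd d,
      min ((n : ℝ) / (w x y + ∑ i, w x (ys i)))
          (accRatio pi q w x y * n / (w y x + ∑ i, w y (zs i))) *
        ((∏ i, q x (ys i)) * ∏ i, q y (zs i))

/-- Off-diagonal transition density of the ideal kernel `P_∞`. -/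
def pIdeal (pi : Rd d → ℝ) (q w : Rd d → Rd d → ℝ) (x y : Rd d) : ℝ :=
  q x y * w x y / qwInt q w x *
    min 1 (accRatio pi q w x y * qwInt q w x / qwInt q w y)

/-- The Dirichlet form `ℰ(P,f) = (1/2) ∫∫ (f(x) - f(y))² p(x,y) π(x) dx dy`
of a kernel with off-diagonal density `p`. -/
def dform (pi : Rd d → ℝ) (p : Rd d → Rd d → ℝ) (f : Rd d → ℝ) : ℝ≥0∞ :=
  (1 / 2 : ℝ≥0∞) * ∫⁻ x, ∫⁻ y, ENNReal.ofReal ((f x - f y) ^ 2 * p x y * pi x)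

/-- The probability measure with density `π` with respect to Lebesgue measure. -/
def piMeasure (pi : Rd d → ℝ) : Measure (Rd d) :=
  volume.withDensity fun x => ENNReal.ofReal (pi x)

/-- The oscillation seminorm `‖f‖_osc = esssup_π f - essinf_π f`, expressed in
`ℝ≥0∞` as the essential supremum of `(f(x) - f(y))⁺` under `π ⊗ π`. -/
def oscSeminorm (pi : Rd d → ℝ) (f : Rd d → ℝ) : ℝ≥0∞ :=
  essSup (fun p : Rd d × Rd d => ENNReal.ofReal (f p.1 - f p.2))
    ((piMeasure pi).prod (piMeasure pi))

/-- `hₙ(x,y) = ∫ n/(ϖ(x,y) + Σᵢ ϖ(x,yᵢ)) Πᵢ q(x,yᵢ) dyᵢ`. -/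
def hFun (q w : Rd d → Rd d → ℝ) (n : ℕ) (x y : Rd d) : ℝ :=
  ∫ ys : Fin (n - 1) → Rd d,
    ((n : ℝ) / (impW q w x y + ∑ i, impW q w x (ys i))) * ∏ i, q x (ys i)

/-- `β₁ₙ(s) = ∫∫ 1{hₙ(x,y) ≤ 1/s} q^w(x,y) π(x) dy dx`. -/
def beta1 (pi : Rd d → ℝ) (q w : Rd d → Rd d → ℝ) (n : ℕ) (s : ℝ) : ℝ≥0∞ :=
  ∫⁻ x, ∫⁻ y,
    if hFun q w n x y ≤ 1 / s then
      ENNReal.ofReal (q x y * w x y / qwInt q w x * pi x)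
    else 0

/-- The `p`-th moment of the importance weights,
`M_ϖ(p) = ∫∫ ϖ(x,y)^p q(x,y) π(x) dy dx`. -/
def momW (pi : Rd d → ℝ) (q w : Rd d → Rd d → ℝ) (p : ℝ) : ℝ≥0∞ :=
  ∫⁻ x, ∫⁻ y, ENNReal.ofReal (impW q w x y ^ p * q x y * pi x)

lemma mul_prod_eq_prod_ite {ι E : Type*} [Fintype ι] [DecidableEq ι] (g v : E → ℝ) (i : ι)
    (ys : ι → E) : v (ys i) * ∏ j, g (ys j) =
      ∏ j, (if j = i then fun y => v y * g y else g) (ys j) := by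
  rw [← Finset.mul_prod_erase univ _ (Finset.mem_univ i),
    ← Finset.mul_prod_erase univ (fun j => (if j = i then fun y => v y * g y else g) (ys j))
      (Finset.mem_univ i), if_pos rfl, mul_assoc]
  congr 2
  refine Finset.prod_congr rfl fun j hj => ?_
  rw [if_neg (Finset.ne_of_mem_erase hj)]

lemma integrable_mul_prod_of_density {ι E : Type*} [Fintype ι] [MeasureSpace E]
    [SigmaFinite (volume : Measure E)] {g v : E → ℝ} (hg : Integrable g)
    (hvg : Integrable fun y => v y * g y) (i : ι) :
    Integrable (fun ys : ι → E => v (ys i) * ∏ j, g (ys j)) := by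
  classical
  simp_rw [mul_prod_eq_prod_ite]
  refine Integrable.fintype_prod fun j => ?_
  split_ifs
  exacts [hvg, hg]

lemma integral_mul_prod_of_density {ι E : Type*} [Fintype ι] [MeasureSpace E]
    [SigmaFinite (volume : Measure E)] {g v : E → ℝ} (hg : ∫ y, g y = 1) (i : ι) :
    ∫ ys : ι → E, v (ys i) * ∏ j, g (ys j) = ∫ y, v y * g y := by
  classical
  simp_rw [mul_prod_eq_prod_ite]
  rw [integral_fintype_prod_volume_eq_prod
    (fun j : ι => if j = i then fun y => v y * g y else g),
    Finset.prod_eq_single i]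
  · simp
  · intro j _ hj
    simp [hj, hg]
  · simp

/-- Jensen's inequality for `t ↦ N / t` at an independent sum of mean-one weights. -/
lemma div_add_card_le_integral {ι E : Type*} [Fintype ι] [MeasureSpace E]
    [SigmaFinite (volume : Measure E)] {g v : E → ℝ} (hg0 : ∀ y, 0 ≤ g y)
    (hg : Integrable g) (hg1 : ∫ y, g y = 1) (hv0 : ∀ y, 0 ≤ v y) (hv : Measurable v)
    (hvg : Integrable fun y => v y * g y) (hvg1 : ∫ y, v y * g y = 1)
    {a N : ℝ} (ha : 0 < a) (hN : 0 ≤ N) :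
    N / (a + Fintype.card ι) ≤
      ∫ ys : ι → E, N / (a + ∑ i, v (ys i)) * ∏ i, g (ys i) := by
  set m : ℝ := a + Fintype.card ι with hm
  have hm0 : 0 < m := by positivity
  have hS : ∀ ys : ι → E, 0 ≤ ∑ i, v (ys i) := fun ys => Finset.sum_nonneg fun i _ => hv0 _
  have hG : ∀ ys : ι → E, 0 ≤ ∏ i, g (ys i) := fun ys => Finset.prod_nonneg fun i _ => hg0 _
  have hGint : Integrable (fun ys : ι → E => ∏ i, g (ys i)) :=
    Integrable.fintype_prod (f := fun _ : ι => g) fun _ => hg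
  have hG1 : ∫ ys : ι → E, ∏ i, g (ys i) = 1 := by
    rw [integral_fintype_prod_volume_eq_pow, hg1, one_pow]
  have hSint : Integrable (fun ys : ι → E => ∑ i, v (ys i) * ∏ j, g (ys j)) :=
    integrable_finsetSum _ fun i _ => integrable_mul_prod_of_density hg hvg i
  have hS1 : ∫ ys : ι → E, ∑ i, v (ys i) * ∏ j, g (ys j) = Fintype.card ι := by
    rw [integral_finsetSum _ fun i _ => integrable_mul_prod_of_density hg hvg i]
    simp [integral_mul_prod_of_density hg1, hvg1]
  have hR : Integrable fun ys : ι → E => N / (a + ∑ i, v (ys i)) * ∏ i, g (ys i) := by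
    refine (hGint.const_mul (N / a)).mono' ?_ (ae_of_all _ fun ys => ?_)
    · refine AEStronglyMeasurable.mul ?_ hGint.aestronglyMeasurable
      exact (by fun_prop : Measurable fun ys : ι → E =>
        N / (a + ∑ i, v (ys i))).aestronglyMeasurable
    · have := hS ys
      rw [Real.norm_of_nonneg (mul_nonneg (by positivity) (hG ys))]
      refine mul_le_mul_of_nonneg_right ?_ (hG ys)
      gcongr
      linarith
  have hL : ∫ ys : ι → E, ((N * (2 / m - a / m ^ 2)) * ∏ i, g (ys i) -
      (N / m ^ 2) * ∑ i, v (ys i) * ∏ j, g (ys j)) = N / m := by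
    rw [integral_sub (hGint.const_mul _) (hSint.const_mul _), integral_const_mul,
      integral_const_mul, hG1, hS1]
    have : (Fintype.card ι : ℝ) = m - a := by rw [hm]; ring
    rw [this]
    field_simp
    ring
  rw [← hL]
  refine integral_mono ((hGint.const_mul _).sub (hSint.const_mul _)) hR fun ys => ?_
  have hpos : 0 < a + ∑ i, v (ys i) := by linarith [hS ys]
  have htan : 2 / m - (a + ∑ i, v (ys i)) / m ^ 2 ≤ 1 / (a + ∑ i, v (ys i)) := by
    generalize a + ∑ i, v (ys i) = t at hpos
    have : 1 / t - (2 / m - t / m ^ 2) = (m - t) ^ 2 / (t * m ^ 2) := by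
      field_simp
      ring
    have h2 : 0 ≤ (m - t) ^ 2 / (t * m ^ 2) := by positivity
    linarith
  have := mul_le_mul_of_nonneg_right (mul_le_mul_of_nonneg_left htan hN) (hG ys)
  dsimp only
  rw [← Finset.sum_mul]
  calc _ = N * (2 / m - (a + ∑ i, v (ys i)) / m ^ 2) * ∏ i, g (ys i) := by ring
    _ ≤ _ := this
    _ = _ := by ring

/-- Jensen's inequality: the `p`-th moment of a mean-one nonnegative weight is at least one. -/
lemma one_le_lintegral_rpow_mul {E : Type*} [MeasurableSpace E] {μ : Measure E} {g v : E → ℝ}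
    (hg0 : ∀ y, 0 ≤ g y) (hg : Integrable g μ) (hg1 : ∫ y, g y ∂μ = 1) (hv0 : ∀ y, 0 ≤ v y)
    (hvg : Integrable (fun y => v y * g y) μ) (hvg1 : ∫ y, v y * g y ∂μ = 1)
    {p : ℝ} (hp : 1 ≤ p) :
    1 ≤ ∫⁻ y, ENNReal.ofReal (v y ^ p * g y) ∂μ := by
  have hg1' : ∫⁻ y, ENNReal.ofReal (g y) ∂μ = 1 := by
    rw [← ofReal_integral_eq_lintegral_ofReal hg (ae_of_all _ hg0), hg1, ENNReal.ofReal_one]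
  have hvg1' : ∫⁻ y, ENNReal.ofReal (v y * g y) ∂μ = 1 := by
    rw [← ofReal_integral_eq_lintegral_ofReal hvg
      (ae_of_all _ fun y => mul_nonneg (hv0 y) (hg0 y)), hvg1, ENNReal.ofReal_one]
  have hmain : ENNReal.ofReal p ≤
      (∫⁻ y, ENNReal.ofReal (v y ^ p * g y) ∂μ) + ENNReal.ofReal (p - 1) := by
    calc ENNReal.ofReal p
        = ∫⁻ y, ENNReal.ofReal p * ENNReal.ofReal (v y * g y) ∂μ := by
          rw [lintegral_const_mul' _ _ ENNReal.ofReal_ne_top, hvg1', mul_one]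
      _ ≤ ∫⁻ y, (ENNReal.ofReal (v y ^ p * g y) +
            ENNReal.ofReal (p - 1) * ENNReal.ofReal (g y)) ∂μ := by
          refine lintegral_mono fun y => ?_
          dsimp only
          have hb := one_add_mul_self_le_rpow_one_add
            (by linarith [hv0 y] : -1 ≤ v y - 1) hp
          rw [add_sub_cancel] at hb
          rw [← ENNReal.ofReal_mul (by linarith), ← ENNReal.ofReal_mul (by linarith),
            ← ENNReal.ofReal_add (mul_nonneg (Real.rpow_nonneg (hv0 y) p) (hg0 y))
              (mul_nonneg (by linarith) (hg0 y))]
          refine ENNReal.ofReal_le_ofReal ?_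
          nlinarith [mul_le_mul_of_nonneg_right hb (hg0 y)]
      _ = _ := by
          rw [lintegral_add_right' _ (hg.aemeasurable.ennreal_ofReal.const_mul _),
            lintegral_const_mul' _ _ ENNReal.ofReal_ne_top, hg1', mul_one]
  have hsplit : ENNReal.ofReal p = 1 + ENNReal.ofReal (p - 1) := by
    rw [← ENNReal.ofReal_one, ← ENNReal.ofReal_add zero_le_one (by linarith), add_sub_cancel]
  rw [hsplit] at hmain
  exact (ENNReal.add_le_add_iff_right ENNReal.ofReal_ne_top).1 hmain

/-- Convexity of `t ↦ t ^ p`, applied to the average of one weight `a` and `n - 1` ones. -/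
lemma rpow_avg_with_ones_le {n a p : ℝ} (hn : 1 ≤ n) (ha : 0 ≤ a) (hp : 1 ≤ p) :
    ((a + (n - 1)) / n) ^ p ≤ n⁻¹ * a ^ p + 1 := by
  have hn0 : 0 < n := by linarith
  have hinv : n⁻¹ ≤ 1 := inv_le_one_of_one_le₀ hn
  have h := (convexOn_rpow hp).2 (Set.mem_Ici.2 ha) (Set.mem_Ici.2 zero_le_one)
    (inv_nonneg.2 hn0.le) (sub_nonneg.2 hinv) (by ring)
  simp only [smul_eq_mul, Real.one_rpow, mul_one] at h
  have he : (a + (n - 1)) / n = n⁻¹ * a + (1 - n⁻¹) := by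
    field_simp
  rw [he]
  linarith [inv_nonneg.2 hn0.le]

section ImportanceWeights

variable {q w : Rd d → Rd d → ℝ}

lemma qwInt_pos (hq_pos : ∀ x y, 0 < q x y) (hw_pos : ∀ x y, 0 < w x y)
    (hqw_int : ∀ x, Integrable fun y => q x y * w x y) (x : Rd d) : 0 < qwInt q w x := by
  have hpos : ∀ y, 0 < q x y * w x y := fun y => mul_pos (hq_pos x y) (hw_pos x y)
  unfold qwInt
  rw [integral_pos_iff_support_of_nonneg (fun y => (hpos y).le) (hqw_int x),
    Set.eq_univ_of_forall fun y => Function.mem_support.2 (hpos y).ne']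
  exact Measure.measure_univ_pos.2 (NeZero.ne _)

lemma integrable_impW_mul (hqw_int : ∀ x, Integrable fun y => q x y * w x y) (x : Rd d) :
    Integrable fun y => impW q w x y * q x y := by
  refine ((hqw_int x).div_const (qwInt q w x)).congr (ae_of_all _ fun y => ?_)
  simp only [impW]
  ring

lemma integral_impW_mul {x : Rd d} (hx : qwInt q w x ≠ 0) :
    ∫ y, impW q w x y * q x y = 1 := by
  calc ∫ y, impW q w x y * q x y = ∫ y, (q x y * w x y) / qwInt q w x := by
        refine integral_congr_ae (ae_of_all _ fun y => ?_)
        simp only [impW]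
        ring
    _ = 1 := by rw [integral_div]; exact div_self hx

lemma measurable_impW (hq_meas : Measurable (Function.uncurry q))
    (hw_meas : Measurable (Function.uncurry w)) :
    Measurable (Function.uncurry (impW q w)) := by
  have hprod : Measurable fun z : Rd d × Rd d => q z.1 z.2 * w z.1 z.2 := hq_meas.mul hw_meas
  have hqw : Measurable fun x => ∫ y, q x y * w x y :=
    (StronglyMeasurable.integral_prod_right' (ν := (volume : Measure (Rd d)))
      hprod.stronglyMeasurable).measurable
  have hqw' : Measurable fun z : Rd d × Rd d => qwInt q w z.1 := hqw.comp measurable_fst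
  exact hw_meas.div hqw'

end ImportanceWeights

/-- If `M_ϖ(p), M_ϖ(p+1) < ∞` for some `p ≥ 1`, then
`β₁ₙ(s) ≤ s^(-p) (n⁻¹ M_ϖ(p+1) + M_ϖ(p))` for all `n ≥ 1`, `s > 0`. -/
theorem beta1_moment_bound {d : ℕ}
    (pi : Rd d → ℝ) (q w : Rd d → Rd d → ℝ)
    (hpi_meas : Measurable pi) (hpi_pos : ∀ x, 0 < pi x)
    (hpi_prob : (∫ x, pi x) = 1)
    (hq_meas : Measurable (Function.uncurry q)) (hq_pos : ∀ x y, 0 < q x y)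
    (hq_prob : ∀ x, (∫ y, q x y) = 1)
    (hw_meas : Measurable (Function.uncurry w)) (hw_pos : ∀ x y, 0 < w x y)
    (hqw_int : ∀ x, Integrable fun y => q x y * w x y)
    (p : ℝ) (hp : 1 ≤ p)
    (hMp : momW pi q w p < ∞) (hMp1 : momW pi q w (p + 1) < ∞)
    (n : ℕ) (hn : 1 ≤ n) (s : ℝ) (hs : 0 < s) :
    beta1 pi q w n s ≤
      ENNReal.ofReal (s ^ (-p)) *
        ((n : ℝ≥0∞)⁻¹ * momW pi q w (p + 1) + momW pi q w p) := by
  have hZ := qwInt_pos hq_pos hw_pos hqw_int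
  have hW0 : ∀ x y, 0 < impW q w x y := fun x y => div_pos (hw_pos x y) (hZ x)
  have hWm := measurable_impW hq_meas hw_meas
  have hqint : ∀ x, Integrable fun y => q x y := fun x =>
    Integrable.of_integral_ne_zero (by rw [hq_prob x]; exact one_ne_zero)
  have hWint := integrable_impW_mul hqw_int
  have hW1 : ∀ x, ∫ y, impW q w x y * q x y = 1 := fun x => integral_impW_mul (hZ x).ne'
  have hn1 : (1 : ℝ) ≤ n := by exact_mod_cast hn
  have hn0 : (0 : ℝ) < n := by linarith
  have hweight : ∀ x y, hFun q w n x y ≤ 1 / s →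
      1 ≤ s ^ (-p) * ((n : ℝ)⁻¹ * impW q w x y ^ p + 1) := by
    intro x y hxy
    have hJ : (n : ℝ) / (impW q w x y + (n - 1)) ≤ 1 / s := by
      refine le_trans ?_ hxy
      have := div_add_card_le_integral (ι := Fin (n - 1)) (fun y => (hq_pos x y).le) (hqint x)
        (hq_prob x) (fun y => (hW0 x y).le) (hWm.comp measurable_prodMk_left) (hWint x) (hW1 x)
        (hW0 x y) hn0.le
      rwa [Fintype.card_fin, Nat.cast_sub hn, Nat.cast_one] at this
    have hs_le : s ≤ (impW q w x y + (n - 1)) / n := by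
      have hm : 0 < impW q w x y + ((n : ℝ) - 1) := by linarith [hW0 x y]
      rw [div_le_div_iff₀ hm hs] at hJ
      rw [le_div_iff₀ hn0]
      linarith
    have hsp : s ^ p ≤ (n : ℝ)⁻¹ * impW q w x y ^ p + 1 :=
      (Real.rpow_le_rpow hs.le hs_le (by linarith)).trans
        (rpow_avg_with_ones_le hn1 (hW0 x y).le hp)
    calc (1 : ℝ) = s ^ (-p) * s ^ p := by
          rw [← Real.rpow_add hs, neg_add_cancel, Real.rpow_zero]
      _ ≤ _ := mul_le_mul_of_nonneg_left hsp (Real.rpow_nonneg hs.le _)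
  have hmeas : Measurable fun z : Rd d × Rd d =>
      ENNReal.ofReal (impW q w z.1 z.2 ^ (p + 1) * q z.1 z.2 * pi z.1) :=
    (((hWm.pow_const (p + 1)).mul hq_meas).mul (hpi_meas.comp measurable_fst)).ennreal_ofReal
  have hmeas_slice : ∀ x, Measurable fun y =>
      ENNReal.ofReal (impW q w x y ^ (p + 1) * q x y * pi x) :=
    fun x => by simpa only [Function.comp_def] using hmeas.comp (measurable_prodMk_left (x := x))
  have hninv : (n : ℝ≥0∞)⁻¹ = ENNReal.ofReal ((n : ℝ)⁻¹) := by
    rw [ENNReal.ofReal_inv_of_pos hn0, ENNReal.ofReal_natCast]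
  have hninv_top : (n : ℝ≥0∞)⁻¹ ≠ ∞ := hninv ▸ ENNReal.ofReal_ne_top
  have hmass : ∀ x, ∫⁻ y, ENNReal.ofReal (impW q w x y * q x y * pi x) ≤
      ∫⁻ y, ENNReal.ofReal (impW q w x y ^ p * q x y * pi x) := by
    intro x
    simp_rw [ENNReal.ofReal_mul' (hpi_pos x).le]
    rw [lintegral_mul_const' _ _ ENNReal.ofReal_ne_top,
      lintegral_mul_const' _ _ ENNReal.ofReal_ne_top,
      ← ofReal_integral_eq_lintegral_ofReal (hWint x)
        (ae_of_all _ fun y => mul_nonneg (hW0 x y).le (hq_pos x y).le), hW1,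
      ENNReal.ofReal_one]
    gcongr
    exact one_le_lintegral_rpow_mul (fun y => (hq_pos x y).le) (hqint x) (hq_prob x)
      (fun y => (hW0 x y).le) (hWint x) (hW1 x) hp
  have hinner : ∀ x, (∫⁻ y, if hFun q w n x y ≤ 1 / s then
        ENNReal.ofReal (q x y * w x y / qwInt q w x * pi x) else 0) ≤
      ENNReal.ofReal (s ^ (-p)) *
        ((n : ℝ≥0∞)⁻¹ * (∫⁻ y, ENNReal.ofReal (impW q w x y ^ (p + 1) * q x y * pi x)) +
          ∫⁻ y, ENNReal.ofReal (impW q w x y ^ p * q x y * pi x)) := by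
    intro x
    calc _ ≤ ∫⁻ y, ENNReal.ofReal (s ^ (-p)) *
          ((n : ℝ≥0∞)⁻¹ * ENNReal.ofReal (impW q w x y ^ (p + 1) * q x y * pi x) +
            ENNReal.ofReal (impW q w x y * q x y * pi x)) := by
          refine lintegral_mono fun y => ?_
          dsimp only
          split_ifs with hxy
          · have hqpi : 0 ≤ impW q w x y * q x y * pi x :=
              mul_nonneg (mul_nonneg (hW0 x y).le (hq_pos x y).le) (hpi_pos x).le
            have hqpi' : 0 ≤ impW q w x y ^ (p + 1) * q x y * pi x :=
              mul_nonneg (mul_nonneg (Real.rpow_nonneg (hW0 x y).le _) (hq_pos x y).le)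
                (hpi_pos x).le
            rw [hninv, ← ENNReal.ofReal_mul (inv_nonneg.2 hn0.le),
              ← ENNReal.ofReal_add (mul_nonneg (inv_nonneg.2 hn0.le) hqpi') hqpi,
              ← ENNReal.ofReal_mul (Real.rpow_nonneg hs.le _)]
            refine ENNReal.ofReal_le_ofReal ?_
            rw [Real.rpow_add_one (hW0 x y).ne']
            calc q x y * w x y / qwInt q w x * pi x
                = 1 * (impW q w x y * q x y * pi x) := by simp only [impW]; ring
              _ ≤ _ := mul_le_mul_of_nonneg_right (hweight x y hxy) hqpi
              _ = _ := by ring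
          · exact zero_le
      _ = ENNReal.ofReal (s ^ (-p)) *
          ((n : ℝ≥0∞)⁻¹ * (∫⁻ y, ENNReal.ofReal (impW q w x y ^ (p + 1) * q x y * pi x)) +
            ∫⁻ y, ENNReal.ofReal (impW q w x y * q x y * pi x)) := by
          rw [lintegral_const_mul' _ _ ENNReal.ofReal_ne_top,
            lintegral_add_left ((hmeas_slice x).const_mul _),
            lintegral_const_mul' _ _ hninv_top]
      _ ≤ _ := mul_le_mul_right (add_le_add_right (hmass x) _) _
  refine (lintegral_mono hinner).trans_eq ?_
  rw [lintegral_const_mul' _ _ ENNReal.ofReal_ne_top,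
    lintegral_add_left (hmeas.lintegral_prod_right'.const_mul _),
    lintegral_const_mul' _ _ hninv_top]
  rfl

end
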